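/- Let m: G_m^n → G_m be the multiplication character m(t_1,...,t_n) = t_1···t_n over a non-archimedean local field F, and let f(t) = t_1 + ... + t_n. For r > 0 set T(r) = {t ∈ (F*)^n : |f(t)| ≤ r}. Then for every compact open subset C ⊂ F* and every r, the integral ∫_{m^{-1}(C) ∩ T(r)} |dt_1 ··· dt_n| (with respect to the additive Haar measure on F^n restricted to (F*)^n) is finite. -/

import Mathlib

open MeasureTheory
open scoped NNReal ENNReal Pointwise

lemma aux_lint_prod {F : Type*} [MeasurableSpace F] (μ : Measure F) [SigmaFinite μ]
    (g : F → ℝ≥0∞) (hg : Measurable g) (m : ℕ) :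
    ∫⁻ u, ∏ j, g (u j) ∂(Measure.pi fun _ : Fin m => μ) = (∫⁻ x, g x ∂μ) ^ m := by
  induction m with
  | zero => simp
  | succ m ih =>
    have h := (measurePreserving_piFinSuccAbove (fun _ : Fin (m+1) => μ) 0)
    have h2 : ∀ u : Fin (m+1) → F, ∏ j, g (u j) =
        (fun z : F × (Fin m → F) => g z.1 * ∏ j, g (z.2 j))
          (MeasurableEquiv.piFinSuccAbove (fun _ : Fin (m+1) => F) 0 u) := by
      intro u
      rw [Fin.prod_univ_succ]
      rfl
    rw [lintegral_congr h2, h.lintegral_comp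
      (f := fun z : F × (Fin m → F) => g z.1 * ∏ j, g (z.2 j)) (by fun_prop)]
    rw [lintegral_prod_mul (f := g) (g := fun z : Fin m → F => ∏ j, g (z j)) hg.aemeasurable (Measurable.aemeasurable (by fun_prop)), ih, pow_succ']

lemma aux_shell {F : Type*} [NontriviallyNormedField F] [IsUltrametricDist F] [ProperSpace F]
    [MeasurableSpace F] [BorelSpace F]
    (μ : Measure F) [μ.IsAddHaarMeasure] :
    ∃ R : ℝ, 1 < R ∧ ∃ q : ℝ≥0, 1 < q ∧ ∃ M : ℝ≥0, ∀ k : ℤ,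
      μ {x | R ^ k ≤ ‖x‖ ∧ ‖x‖ < R ^ (k+1)} ≤ ((q ^ k * M : ℝ≥0) : ℝ≥0∞) := by
  obtain ⟨c, hc⟩ := NormedField.exists_lt_norm F 1
  have hc0 : c ≠ 0 := by rintro rfl; simp at hc; linarith
  have hcp : 0 < ‖c‖ := by positivity
  let cu : Fˣ := Units.mk0 c hc0
  let B := Metric.closedBall (0:F) 1
  have hB : μ B ≠ ⊤ := (isCompact_closedBall _ _).measure_ne_top
  have hB0 : μ B ≠ 0 := (Metric.measure_closedBall_pos μ _ one_pos).ne'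
  refine ⟨‖c‖, hc, distribHaarChar F cu, ?_, (μ (Metric.closedBall 0 ‖c‖)).toNNReal, ?_⟩
  · have h1 := distribHaarChar_mul μ cu B
    have h2 : B ∪ (c +ᵥ B) ⊆ cu • B := by
      intro x hx
      rw [Set.mem_smul_set_iff_inv_smul_mem]
      simp only [B, cu, mem_closedBall_zero_iff, Units.smul_def, Units.val_inv_eq_inv_val, Units.val_mk0, smul_eq_mul, norm_mul, norm_inv]
      rw [inv_mul_le_one₀ hcp]
      rcases hx with hx | ⟨y, hy, rfl⟩
      · exact (mem_closedBall_zero_iff.1 hx).trans hc.le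
      · have := mem_closedBall_zero_iff.1 hy
        exact (IsUltrametricDist.norm_add_le_max c y).trans (max_le le_rfl (this.trans hc.le))
    have h3 : Disjoint B (c +ᵥ B) := by
      rw [Set.disjoint_left]
      rintro x hx ⟨y, hy, rfl⟩
      have hx := mem_closedBall_zero_iff.1 hx
      have hy := mem_closedBall_zero_iff.1 hy
      have := IsUltrametricDist.norm_add_le_max (c + y) (-y)
      simp only [add_neg_cancel_right, norm_neg] at this
      have := this.trans (max_le hx hy)
      linarith
    have h4 : μ (c +ᵥ B) = μ B := measure_vadd μ c B
    have h5 : μ B + μ B ≤ distribHaarChar F cu * μ B := by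
      rw [h1]
      refine le_trans ?_ (measure_mono h2)
      rw [measure_union' h3 Metric.isClosed_closedBall.measurableSet, h4]
    by_contra hq
    push Not at hq
    have h6 : μ B + μ B ≤ 1 * μ B := h5.trans (by gcongr; exact_mod_cast hq)
    rw [one_mul] at h6
    exact (ENNReal.lt_add_right hB hB0).not_ge h6
  · intro k
    have hM : ((μ (Metric.closedBall 0 ‖c‖)).toNNReal : ℝ≥0∞) = μ (Metric.closedBall 0 ‖c‖) :=
      ENNReal.coe_toNNReal (isCompact_closedBall _ _).measure_ne_top
    rw [ENNReal.coe_mul, hM, ← map_zpow, distribHaarChar_mul]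
    apply measure_mono
    rintro x ⟨-, hx⟩
    rw [Set.mem_smul_set_iff_inv_smul_mem]
    have hk : 0 < ‖c‖ ^ k := by positivity
    simp only [cu, mem_closedBall_zero_iff, Units.smul_def, Units.val_inv_eq_inv_val, Units.val_zpow_eq_zpow_val, Units.val_mk0, smul_eq_mul, norm_mul, norm_inv, norm_zpow]
    rw [inv_mul_le_iff₀ hk, ← zpow_add_one₀ hcp.ne']
    exact hx.le

lemma aux_comb (m : ℕ) (k : Fin m → ℤ) (K D : ℤ) (hK : 0 ≤ K) (hk : ∀ j, k j ≤ K)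
    (h1 : -D ≤ K + ∑ j, k j) (h2 : K + ∑ j, k j ≤ D) :
    0 ≤ (2*m+2)*D + ∑ j, (-(2*m+1) * k j - |k j|) := by
  have h3 : ∑ j, |k j| ≤ ∑ j, (2 * K - k j) := by
    apply Finset.sum_le_sum
    intro j _
    have := hk j
    rcases abs_cases (k j) with h | h <;> linarith
  rw [Finset.sum_sub_distrib] at h3 ⊢
  rw [← Finset.mul_sum]
  simp at h3
  have hm : (0:ℤ) ≤ m := by positivity
  nlinarith

/-- the weight function -/
noncomputable def auxG {F : Type*} [NontriviallyNormedField F] (R : ℝ) (p : ℝ≥0) (m : ℕ) (x : F) : ℝ≥0∞ :=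
  ∑' k : ℤ, ({x : F | R ^ k ≤ ‖x‖ ∧ ‖x‖ < R ^ (k+1)}).indicator
    (fun _ => ((p ^ (-(2*m+1) * k - |k|) : ℝ≥0) : ℝ≥0∞)) x

lemma aux_meas {F : Type*} [NontriviallyNormedField F] [MeasurableSpace F] [BorelSpace F] (R : ℝ) (k : ℤ) :
    MeasurableSet {x : F | R ^ k ≤ ‖x‖ ∧ ‖x‖ < R ^ (k+1)} := by
  have h1 : MeasurableSet {x : F | R ^ k ≤ ‖x‖} := measurableSet_le (by fun_prop) (by fun_prop)
  have h2 : MeasurableSet {x : F | ‖x‖ < R ^ (k+1)} := measurableSet_lt (by fun_prop) (by fun_prop)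
  exact h1.inter h2

lemma auxG_meas {F : Type*} [NontriviallyNormedField F] [MeasurableSpace F] [BorelSpace F]
    (R : ℝ) (p : ℝ≥0) (m : ℕ) : Measurable (auxG (F := F) R p m) := by
  unfold auxG
  exact Measurable.tsum fun k => measurable_const.indicator (aux_meas R k)

lemma auxG_ge {F : Type*} [NontriviallyNormedField F] (R : ℝ) (p : ℝ≥0) (m : ℕ) (x : F) (k : ℤ)
    (h : R ^ k ≤ ‖x‖ ∧ ‖x‖ < R ^ (k+1)) :
    ((p ^ (-(2*m+1) * k - |k|) : ℝ≥0) : ℝ≥0∞) ≤ auxG R p m x := by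
  unfold auxG
  refine le_trans ?_ (ENNReal.le_tsum k)
  rw [Set.indicator_of_mem (by exact h)]

lemma auxG_fin {F : Type*} [NontriviallyNormedField F] [MeasurableSpace F] [BorelSpace F]
    (μ : Measure F) (R : ℝ) (p q M : ℝ≥0) (m : ℕ) (hp : 1 < p) (hpq : p ^ (2*m+1) = q)
    (h : ∀ k : ℤ, μ {x | R ^ k ≤ ‖x‖ ∧ ‖x‖ < R ^ (k+1)} ≤ ((q ^ k * M : ℝ≥0) : ℝ≥0∞)) :
    ∫⁻ x, auxG R p m x ∂μ < ⊤ := by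
  unfold auxG
  rw [lintegral_tsum (fun k => (measurable_const.indicator (aux_meas R k)).aemeasurable)]
  have hp0 : p ≠ 0 := by positivity
  have hs : Summable (fun k : ℤ => M * p⁻¹ ^ (k.natAbs)) := by
    apply Summable.mul_left
    have hg : Summable (fun k : ℕ => p⁻¹ ^ k) := NNReal.summable_geometric (inv_lt_one_of_one_lt₀ hp)
    rw [← NNReal.summable_coe] at hg ⊢
    apply Summable.of_nat_of_neg
    · simpa using hg
    · simpa using hg
  refine lt_of_le_of_lt (ENNReal.tsum_le_tsum (g := fun k : ℤ => ((M * p⁻¹ ^ (k.natAbs) : ℝ≥0) : ℝ≥0∞)) ?_) ?_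
  · intro k
    rw [lintegral_indicator_const (aux_meas R k)]
    refine (mul_le_mul_right (h k) _).trans ?_
    rw [← ENNReal.coe_mul, ENNReal.coe_le_coe]
    apply le_of_eq
    rw [← hpq, ← zpow_natCast, ← zpow_natCast, inv_zpow', ← zpow_mul, mul_comm M, ← mul_assoc, ← zpow_add₀ hp0]
    congr 2
    push_cast
    ring
  · exact (ENNReal.tsum_coe_ne_top_iff_summable.2 hs).lt_top

theorem stmt11 {F : Type*} [NontriviallyNormedField F] [IsUltrametricDist F] [ProperSpace F]
    [MeasurableSpace F] [BorelSpace F]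
    (μ : Measure F) [μ.IsAddHaarMeasure] [SigmaFinite μ]
    (n : ℕ) (C : Set F) (hC1 : IsCompact C) (hC2 : IsOpen C) (hC0 : C ⊆ {x : F | x ≠ 0})
    (r : ℝ) :
    (Measure.pi fun _ : Fin n => μ)
      {t : Fin n → F | (∀ i, t i ≠ 0) ∧ (∏ i, t i) ∈ C ∧ ‖∑ i, t i‖ ≤ r} < ⊤ := by
  rcases n with _ | m
  · rw [Measure.pi_of_empty]
    exact measure_lt_top _ _
  obtain ⟨R, hR, q, hq, M, hM⟩ := aux_shell μ
  have hR0 : 0 < R := by linarith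
  obtain ⟨p, hpq⟩ : ∃ p : ℝ≥0, p ^ (2*m+1) = q :=
    ⟨q ^ (((2*m+1 : ℕ) : ℝ)⁻¹), NNReal.rpow_inv_natCast_pow _ (by omega)⟩
  have hp : 1 < p := by
    by_contra hp
    push Not at hp
    have := pow_le_one₀ (n := 2*m+1) (zero_le) hp
    rw [hpq] at this
    exact this.not_gt hq
  have hp0 : p ≠ 0 := by positivity
  -- bounds on C
  obtain ⟨L, hL⟩ : ∃ L : ℤ, ∀ x ∈ C, R ^ (-L) ≤ ‖x‖ ∧ ‖x‖ ≤ R ^ L := by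
    obtain ⟨b, hb⟩ := hC1.isBounded.exists_norm_le
    have h0 : Cᶜ ∈ nhds (0:F) := hC1.isClosed.isOpen_compl.mem_nhds (fun h => hC0 h rfl)
    obtain ⟨δ, hδ, hball⟩ := Metric.mem_nhds_iff.1 h0
    obtain ⟨L1, hL1⟩ := pow_unbounded_of_one_lt b hR
    obtain ⟨L2, hL2⟩ := pow_unbounded_of_one_lt δ⁻¹ hR
    refine ⟨max L1 L2, fun x hx => ⟨?_, ?_⟩⟩
    · have h1 : δ ≤ ‖x‖ := by
        by_contra h
        push Not at h
        exact hball (mem_ball_zero_iff.2 h) hx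
      refine le_trans ?_ h1
      rw [zpow_neg]
      apply inv_le_of_inv_le₀ hδ
      refine hL2.le.trans ?_
      rw [← zpow_natCast]
      exact zpow_le_zpow_right₀ hR.le (le_max_right _ _)
    · refine (hb x hx).trans (hL1.le.trans ?_)
      rw [← zpow_natCast]
      exact zpow_le_zpow_right₀ hR.le (le_max_left _ _)
  let D : ℤ := |L| + (m + 1)
  let E : ℤ := (2*m+2)*D
  let H : F × (Fin m → F) → ℝ≥0∞ := fun z =>
    {z : F × (Fin m → F) | ‖z.1 + ∑ j, z.2 j‖ ≤ r}.indicator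
      (fun z => ((p ^ E : ℝ≥0) : ℝ≥0∞) * ∏ j, auxG R p m (z.2 j)) z
  have hGm := auxG_meas (F := F) R p m
  have hHm : Measurable H := by
    apply Measurable.indicator
    · fun_prop
    · exact measurableSet_le (by fun_prop) (by fun_prop)
  have hHfin : ∫⁻ z, H z ∂(μ.prod (Measure.pi fun _ : Fin m => μ)) < ⊤ := by
    rw [lintegral_prod_symm _ hHm.aemeasurable]
    have : ∀ u : Fin m → F, ∫⁻ x, H (x, u) ∂μ ≤
        (((p ^ E : ℝ≥0) : ℝ≥0∞) * μ (Metric.closedBall 0 r)) * ∏ j, auxG R p m (u j) := by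
      intro u
      have h1 : ∀ x, H (x, u) = (Metric.closedBall (-∑ j, u j) r).indicator
          (fun _ => ((p ^ E : ℝ≥0) : ℝ≥0∞) * ∏ j, auxG R p m (u j)) x := by
        intro x
        have h2 : x ∈ Metric.closedBall (-∑ j, u j) r ↔
            (x, u) ∈ {z : F × (Fin m → F) | ‖z.1 + ∑ j, z.2 j‖ ≤ r} := by
          rw [Metric.mem_closedBall, dist_eq_norm, sub_neg_eq_add]
          rfl
        by_cases hx : x ∈ Metric.closedBall (-∑ j, u j) r
        · simp only [H]
          rw [Set.indicator_of_mem hx, Set.indicator_of_mem (h2.1 hx)]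
        · simp only [H]
          rw [Set.indicator_of_notMem hx, Set.indicator_of_notMem (fun h => hx (h2.2 h))]
      simp_rw [h1]
      rw [lintegral_indicator_const Metric.isClosed_closedBall.measurableSet,
        Measure.addHaar_closedBall_center]
      apply le_of_eq
      ring
    refine lt_of_le_of_lt (lintegral_mono this) ?_
    rw [lintegral_const_mul _ (by fun_prop), aux_lint_prod μ _ hGm]
    refine ENNReal.mul_lt_top (ENNReal.mul_lt_top ENNReal.coe_lt_top
      (isCompact_closedBall _ _).measure_lt_top) (ENNReal.pow_lt_top ?_)
    exact auxG_fin μ R p q M m hp hpq hM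
  let S : Fin (m+1) → Set (Fin (m+1) → F) := fun i =>
    (MeasurableEquiv.piFinSuccAbove (fun _ : Fin (m+1) => F) i) ⁻¹' {z | 1 ≤ H z}
  have hS : ∀ i, (Measure.pi fun _ : Fin (m+1) => μ) (S i) < ⊤ := by
    intro i
    have h := measurePreserving_piFinSuccAbove (fun _ : Fin (m+1) => μ) i
    rw [h.measure_preimage (measurableSet_le measurable_const hHm).nullMeasurableSet]
    refine lt_of_le_of_lt ?_ hHfin
    have := mul_meas_ge_le_lintegral (μ := μ.prod (Measure.pi fun _ : Fin m => μ)) hHm 1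
    rwa [one_mul] at this
  have hcov : {t : Fin (m+1) → F | (∀ i, t i ≠ 0) ∧ (∏ i, t i) ∈ C ∧ ‖∑ i, t i‖ ≤ r} ⊆
      (Metric.closedBall 0 1) ∪ ⋃ i, S i := by
    rintro t ⟨ht0, htC, htr⟩
    by_cases hb : t ∈ Metric.closedBall (0 : Fin (m+1) → F) 1
    · exact Or.inl hb
    right
    obtain ⟨i, -, hi⟩ := Finset.exists_max_image Finset.univ (fun i => ‖t i‖) Finset.univ_nonempty
    have hi1 : 1 < ‖t i‖ := by
      by_contra h
      push Not at h
      apply hb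
      rw [mem_closedBall_zero_iff, pi_norm_le_iff_of_nonneg zero_le_one]
      exact fun j => (hi j (Finset.mem_univ _)).trans h
    rw [Set.mem_iUnion]
    refine ⟨i, ?_⟩
    choose k hk using fun j => exists_mem_Ico_zpow (norm_pos_iff.2 (ht0 j)) hR
    have hkmax : ∀ j, k j ≤ k i := by
      intro j
      have := ((hk j).1.trans (hi j (Finset.mem_univ _))).trans_lt (hk i).2
      have := (zpow_lt_zpow_iff_right₀ hR).1 this
      omega
    have hki : 0 ≤ k i := by
      have := hi1.trans (hk i).2
      rw [← zpow_zero R] at this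
      have := (zpow_lt_zpow_iff_right₀ hR).1 this
      omega
    have hzs : ∀ f : Fin (m+1) → ℤ, ∏ j, R ^ f j = R ^ ∑ j, f j := by
      intro f
      induction (Finset.univ : Finset (Fin (m+1))) using Finset.cons_induction with
      | empty => simp
      | cons a s ha ih => rw [Finset.prod_cons, Finset.sum_cons, zpow_add₀ hR0.ne', ih]
    obtain ⟨hLl, hLu⟩ := hL _ htC
    rw [norm_prod] at hLl hLu
    have e1 : ∑ j, k j ≤ L := by
      have : R ^ ∑ j, k j ≤ R ^ L := by
        rw [← hzs]
        exact (Finset.prod_le_prod (fun j _ => by positivity) (fun j _ => (hk j).1)).trans hLu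
      exact (zpow_le_zpow_iff_right₀ hR).1 this
    have e2 : -L ≤ ∑ j, k j + (m+1) := by
      have : R ^ (-L) ≤ R ^ ∑ j, (k j + 1) := by
        rw [← hzs]
        exact hLl.trans (Finset.prod_le_prod (fun j _ => by positivity) (fun j _ => (hk j).2.le))
      have := (zpow_le_zpow_iff_right₀ hR).1 this
      rw [Finset.sum_add_distrib] at this
      simpa using this
    rw [Fin.sum_univ_succAbove _ i] at e1 e2 htr
    have hcomb := aux_comb m (fun j => k (i.succAbove j)) (k i) D hki (fun j => hkmax _)
      (by have := le_abs_self L; simp only [D]; linarith)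
      (by have := le_abs_self L; simp only [D]; linarith)
    change 1 ≤ H (t i, fun j => t (i.succAbove j))
    simp only [H]
    rw [Set.indicator_of_mem (by exact htr)]
    have hprod : ∏ j : Fin m, ((p ^ (-(2*m+1) * k (i.succAbove j) - |k (i.succAbove j)|) : ℝ≥0) : ℝ≥0∞)
        ≤ ∏ j : Fin m, auxG R p m (t (i.succAbove j)) :=
      Finset.prod_le_prod' fun j _ => auxG_ge R p m _ _ (hk _)
    refine le_trans ?_ (mul_le_mul_right hprod _)
    have hzp : ∀ f : Fin m → ℤ, ∏ j, p ^ f j = p ^ ∑ j, f j := by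
      intro f
      induction (Finset.univ : Finset (Fin m)) using Finset.cons_induction with
      | empty => simp
      | cons a s ha ih => rw [Finset.prod_cons, Finset.sum_cons, zpow_add₀ hp0, ih]
    rw [← ENNReal.ofNNReal_finsetProd, hzp, ← ENNReal.coe_mul, ← zpow_add₀ hp0]
    rw [ENNReal.one_le_coe_iff]
    exact one_le_zpow₀ hp.le hcomb
  refine (measure_mono hcov).trans_lt ((measure_union_le _ _).trans_lt (ENNReal.add_lt_top.2 ⟨?_, ?_⟩))
  · exact (isCompact_closedBall _ _).measure_lt_top
  · refine (measure_iUnion_le _).trans_lt ?_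
    rw [tsum_fintype]
    exact ENNReal.sum_lt_top.2 fun i _ => hS i
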